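/- The function $x \mapsto x^4\left([\psi'(x)]^2 + \psi''(x)\right)$ is completely monotonic on $(0,\infty)$, i.e., $(-1)^n \frac{d^n}{dx^n}\left[x^4\left([\psi'(x)]^2 + \psi''(x)\right)\right] \ge 0$ for all $x > 0$ and all integers $n \ge 0$. -/

import Mathlib

noncomputable def digamma : ℝ → ℝ := deriv (fun x => Real.log (Real.Gamma x))

section
open Real Set Filter Topology MeasureTheory

namespace CMaux

lemma log_le_B (z : ℝ) (h1 : 1 ≤ z) (h6 : z ≤ 6) :
    log z * (2 + 7*z + 62*z^2 + 38*z^3 + 38*z^4 - 5*z^5 + 2*z^6) ≤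
      (z-1) * (6 + 19*z + 66*z^2 + 60*z^3 - 16*z^4 + 9*z^5) := by
  have hDpos : ∀ x : ℝ, 1 ≤ x → 0 < 2 + 7*x + 62*x^2 + 38*x^3 + 38*x^4 - 5*x^5 + 2*x^6 := by
    intro x hx
    obtain ⟨y, hy, rfl⟩ : ∃ y : ℝ, 0 ≤ y ∧ x = 1 + y := ⟨x - 1, by linarith, by ring⟩
    have : 2 + 7*(1+y) + 62*(1+y)^2 + 38*(1+y)^3 + 38*(1+y)^4 - 5*(1+y)^5 + 2*(1+y)^6
      = 144 + 384*y + 384*y^2+180*y^3+43*y^4+7*y^5+2*y^6 := by ring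
    rw [this]; positivity
  let R : Polynomial ℝ := (Polynomial.X - 1) * (6 + 19*Polynomial.X + 66*Polynomial.X^2 + 60*Polynomial.X^3 - 16*Polynomial.X^4 + 9*Polynomial.X^5)
  let D : Polynomial ℝ := 2 + 7*Polynomial.X + 62*Polynomial.X^2 + 38*Polynomial.X^3 + 38*Polynomial.X^4 - 5*Polynomial.X^5 + 2*Polynomial.X^6
  have hD : ∀ x, D.eval x = 2 + 7*x + 62*x^2 + 38*x^3 + 38*x^4 - 5*x^5 + 2*x^6 := by
    intro x; simp [D]
  have hR : ∀ x, R.eval x = (x-1) * (6 + 19*x + 66*x^2 + 60*x^3 - 16*x^4 + 9*x^5) := by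
    intro x; simp [R]
  have hder : ∀ x : ℝ, 1 ≤ x → HasDerivAt (fun x => R.eval x / D.eval x - log x)
      ((R.derivative.eval x * D.eval x - R.eval x * D.derivative.eval x) / (D.eval x)^2 - x⁻¹) x := by
    intro x hx
    exact ((R.hasDerivAt x).div (D.hasDerivAt x) (by rw [hD]; exact (hDpos x hx).ne')).sub
      (hasDerivAt_log (by linarith))
  have hmono : MonotoneOn (fun x => R.eval x / D.eval x - log x) (Icc 1 6) := by
    apply monotoneOn_of_deriv_nonneg (convex_Icc _ _)
    · exact fun x hx => (hder x hx.1).continuousAt.continuousWithinAt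
    · intro x hx
      rw [interior_Icc] at hx
      exact (hder x hx.1.le).differentiableAt.differentiableWithinAt
    · intro x hx
      rw [interior_Icc] at hx
      rw [(hder x hx.1.le).deriv]
      have hx0 : 0 < x := by linarith [hx.1]
      have hd := hDpos x hx.1.le
      rw [← hD] at hd
      have : (R.derivative.eval x * D.eval x - R.eval x * D.derivative.eval x) / (D.eval x)^2 - x⁻¹
        = (x * (R.derivative.eval x * D.eval x - R.eval x * D.derivative.eval x) - (D.eval x)^2)
          / (x * (D.eval x)^2) := by field_simp
      rw [this]
      apply div_nonneg _ (by positivity)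
      have hRd : R.derivative.eval x = -13 - 94*x + 18*x^2 + 304*x^3 - 125*x^4 + 54*x^5 := by
        simp [R]; ring
      have hDd : D.derivative.eval x = 7 + 124*x + 114*x^2+152*x^3-25*x^4+12*x^5 := by
        simp [D]; ring
      rw [hRd, hDd, hR, hD]
      obtain ⟨y, hy, rfl⟩ : ∃ y : ℝ, 0 ≤ y ∧ x = 1 + y := ⟨x - 1, by linarith [hx.1], by ring⟩
      have hy5 : y ≤ 5 := by linarith [hx.2]
      have key : 0 ≤ y^3 * (3456 + 21312*y + 51600*y^2 + 63984*y^3 + 43872*y^4 + 16568*y^5 + y^6*(3173+214*y-23*y^2-4*y^3)) := by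
        have h3 : 0 ≤ 3173+214*y-23*y^2-4*y^3 := by
          have h2 : y^2 ≤ 25 := by nlinarith
          have h3 : y^3 ≤ 125 := by nlinarith
          linarith
        positivity
      refine key.trans_eq ?_
      ring
  have := hmono (show (1:ℝ) ∈ Icc (1:ℝ) 6 by norm_num) ⟨h1, h6⟩ h1
  simp only [hR, hD] at this
  norm_num at this
  rwa [le_div_iff₀ (hDpos z h1)] at this

lemma log_tan (z : ℝ) (hz : 0 < z) (k : ℕ) : log z ≤ z / 2^k + k * 0.6931471808 - 1 := by
  have h := log_le_sub_one_of_pos (show 0 < z / 2^k by positivity)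
  rw [log_div hz.ne' (by positivity), log_pow] at h
  have := log_two_lt_d9
  have : (k:ℝ) * log 2 ≤ k * 0.6931471808 := by gcongr
  linarith

-- K = 7.85
lemma log_le_A (z : ℝ) (h : 5.8 ≤ z) :
    log z * (3*z*(9+42*z^2-8*z^3+5*z^4)) ≤
      (z-1) * ((7 + 10*z + 88*z^2 + 38*z^3 - 7*z^4 + 8*z^5) - 7.85*(z-1)^3*(z^2-6*z+1)) := by
  have hDpos : 0 ≤ 3*z*(9+42*z^2-8*z^3+5*z^4) := by
    have : 0 ≤ 9+42*z^2-8*z^3+5*z^4 := by nlinarith [sq_nonneg (z^2), sq_nonneg (z*(z-1))]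
    positivity
  rcases le_total z 20 with h20 | h20
  · refine (mul_le_mul_of_nonneg_right (log_tan z (by linarith) 3) hDpos).trans ?_
    norm_num
    obtain ⟨y, hy, rfl⟩ : ∃ y : ℝ, 0 ≤ y ∧ z = 5.8 + y := ⟨z - 5.8, by linarith, by ring⟩
    have hy2 : y ≤ 14.2 := by linarith
    have key : 0 ≤ y^3 * (6000 + 390*y - 11*y^2 - 2*y^3) := by
      have : 0 ≤ 6000 + 390*y - 11*y^2 - 2*y^3 := by
        have h2 : y^2 ≤ 14.2*y := by nlinarith
        have h3 : y^3 ≤ 201.64*y := by nlinarith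
        linarith
      positivity
    have h2 := pow_nonneg hy 2
    have h3 := pow_nonneg hy 3
    have h4 := pow_nonneg hy 4
    have h5 := pow_nonneg hy 5
    have h6 := pow_nonneg hy 6
    linarith
  rcases le_total z 60 with h60 | h60
  · refine (mul_le_mul_of_nonneg_right (log_tan z (by linarith) 5) hDpos).trans ?_
    norm_num
    obtain ⟨y, hy, rfl⟩ : ∃ y : ℝ, 0 ≤ y ∧ z = 20 + y := ⟨z - 20, by linarith, by ring⟩
    have hy2 : y ≤ 40 := by linarith
    have key : 0 ≤ y^3 * (46000 + 670*y - 12*y^2 - 0.4*y^3) := by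
      have : 0 ≤ 46000 + 670*y - 12*y^2 - 0.4*y^3 := by
        have h2 : y^2 ≤ 40*y := by nlinarith
        have h3 : y^3 ≤ 1600*y := by nlinarith
        linarith
      positivity
    have h2 := pow_nonneg hy 2
    have h3 := pow_nonneg hy 3
    have h4 := pow_nonneg hy 4
    have h5 := pow_nonneg hy 5
    have h6 := pow_nonneg hy 6
    linarith
  · refine (mul_le_mul_of_nonneg_right (log_tan z (by linarith) 7) hDpos).trans ?_
    norm_num
    obtain ⟨y, hy, rfl⟩ : ∃ y : ℝ, 0 ≤ y ∧ z = 60 + y := ⟨z - 60, by linarith, by ring⟩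
    rw [← sub_nonneg]
    ring_nf
    positivity
end CMaux
end

section
open Real Set Filter Topology MeasureTheory

namespace CMaux

/-- second derivative of the auxiliary function -/
noncomputable def pB (t : ℝ) : ℝ := t/2 - 1 + t/(exp t - 1)
noncomputable def pC (t : ℝ) : ℝ := ((exp t ^2 - 1)/2 - t * exp t) / (exp t - 1)^2
noncomputable def pD (t : ℝ) : ℝ :=
  (t * exp t * (exp t + 1) - 2 * exp t * (exp t - 1)) / (exp t - 1)^3
noncomputable def pA (t : ℝ) : ℝ := ∫ s in (0:ℝ)..t, pB s
noncomputable def pO (t : ℝ) : ℝ := ∫ s in (0:ℝ)..t, pA s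

lemma exp_sub_pos {t : ℝ} (ht : 0 < t) : 0 < exp t - 1 := by
  have := one_lt_exp_iff.2 ht; linarith

lemma pB_nonneg {t : ℝ} (ht : 0 < t) : 0 ≤ pB t := by
  have hz := exp_sub_pos ht
  have hk : MonotoneOn (fun t : ℝ => t/2 * (exp t + 1) - (exp t - 1)) (Ici 0) := by
    have hd : ∀ x : ℝ, HasDerivAt (fun t : ℝ => t/2 * (exp t + 1) - (exp t - 1))
        (1/2 * (exp x + 1) + x/2 * exp x - exp x) x := fun x =>
      (((hasDerivAt_id x).div_const 2).mul ((hasDerivAt_exp x).add_const 1)).sub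
        ((hasDerivAt_exp x).sub_const 1)
    apply monotoneOn_of_deriv_nonneg (convex_Ici _)
    · exact fun x hx => (hd x).continuousAt.continuousWithinAt
    · exact fun x hx => (hd x).differentiableAt.differentiableWithinAt
    · intro x hx
      rw [(hd x).deriv]
      have h1 := add_one_le_exp (-x)
      have h2 : exp (-x) * exp x = 1 := by rw [← exp_add]; simp
      nlinarith [exp_pos x]
  have h := hk (show (0:ℝ) ∈ Ici (0:ℝ) by simp) (show t ∈ Ici (0:ℝ) from ht.le) ht.le
  simp at h
  have : pB t = (t/2 * (exp t + 1) - (exp t - 1)) / (exp t - 1) := by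
    unfold pB; field_simp; ring
  rw [this]
  exact div_nonneg (by linarith) hz.le

lemma pB_le {t : ℝ} (ht : 0 < t) : pB t ≤ t/2 := by
  have hz := exp_sub_pos ht
  have : t/(exp t - 1) ≤ 1 := by
    rw [div_le_one hz]; linarith [add_one_le_exp t]
  unfold pB; linarith

lemma pB_hasDeriv {t : ℝ} (ht : 0 < t) : HasDerivAt pB (pC t) t := by
  have hz := exp_sub_pos ht
  have h := (((hasDerivAt_id t).div_const 2).sub_const 1).add
    ((hasDerivAt_id t).div ((hasDerivAt_exp t).sub_const 1) hz.ne')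
  refine h.congr_deriv ?_
  unfold pC
  simp only [id]
  field_simp
  ring

lemma pC_hasDeriv {t : ℝ} (ht : 0 < t) : HasDerivAt pC (pD t) t := by
  have hz := exp_sub_pos ht
  have h := ((((hasDerivAt_exp t).pow 2).sub_const 1).div_const 2 |>.sub
    ((hasDerivAt_id t).mul (hasDerivAt_exp t))).div
    (((hasDerivAt_exp t).sub_const 1).pow 2) (pow_ne_zero 2 hz.ne')
  refine h.congr_deriv ?_
  unfold pD
  simp only [id, Pi.sub_apply, Pi.pow_apply, Pi.mul_apply]
  field_simp
  ring

lemma pB_contOn : ContinuousOn pB (Ioi 0) := fun x hx =>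
  (pB_hasDeriv hx).continuousAt.continuousWithinAt

lemma pB_int (t : ℝ) (ht : 0 ≤ t) : IntervalIntegrable pB volume 0 t := by
  rw [intervalIntegrable_iff_integrableOn_Ioc_of_le ht]
  refine Integrable.mono' (g := fun s => s/2) ?_ ?_ ?_
  · exact (Continuous.integrableOn_Ioc (by fun_prop))
  · exact (pB_contOn.mono Ioc_subset_Ioi_self).aestronglyMeasurable measurableSet_Ioc
  · refine (ae_restrict_iff' measurableSet_Ioc).2 (Eventually.of_forall fun s hs => ?_)
    rw [norm_eq_abs, abs_of_nonneg (pB_nonneg hs.1)]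
    exact pB_le hs.1

lemma pA_hasDeriv {t : ℝ} (ht : 0 < t) : HasDerivAt pA (pB t) t := by
  apply intervalIntegral.integral_hasDerivAt_right (pB_int t ht.le)
  · exact pB_contOn.stronglyMeasurableAtFilter isOpen_Ioi t ht
  · exact (pB_hasDeriv ht).continuousAt

lemma pA_nonneg {t : ℝ} (ht : 0 ≤ t) : 0 ≤ pA t :=
  intervalIntegral.integral_nonneg_of_ae_restrict ht (by
    rw [← Measure.restrict_congr_set (Ioc_ae_eq_Icc (μ := volume))]
    exact (ae_restrict_iff' measurableSet_Ioc).2 (Eventually.of_forall fun s hs => pB_nonneg hs.1))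

lemma pA_le {t : ℝ} (ht : 0 ≤ t) : pA t ≤ t^2/4 := by
  have h : pA t ≤ ∫ s in (0:ℝ)..t, s/2 := by
    apply intervalIntegral.integral_mono_on_of_le_Ioo ht (pB_int t ht)
      (Continuous.intervalIntegrable (by fun_prop) _ _)
    exact fun s hs => pB_le hs.1
  refine h.trans_eq ?_
  simp
  ring

lemma pA_contOn : ContinuousOn pA (Ici 0) := by
  intro x hx
  rcases eq_or_lt_of_le (show (0:ℝ) ≤ x from hx) with rfl | hx
  · have h0 : pA 0 = 0 := by simp [pA]
    rw [ContinuousWithinAt, h0]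
    refine tendsto_of_tendsto_of_tendsto_of_le_of_le' tendsto_const_nhds (h := fun t => t^2/4) ?_
      (eventually_mem_nhdsWithin.mono fun t ht => pA_nonneg ht)
      (eventually_mem_nhdsWithin.mono fun t ht => pA_le ht)
    have : ContinuousWithinAt (fun t : ℝ => t^2/4) (Ici 0) 0 := by fun_prop
    simpa [ContinuousWithinAt] using this
  · exact (pA_hasDeriv hx).continuousAt.continuousWithinAt

lemma pA_int (t : ℝ) (ht : 0 ≤ t) : IntervalIntegrable pA volume 0 t :=
  (pA_contOn.mono (by rw [uIcc_of_le ht]; exact Icc_subset_Ici_self)).intervalIntegrable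

lemma pO_hasDeriv {t : ℝ} (ht : 0 < t) : HasDerivAt pO (pA t) t := by
  apply intervalIntegral.integral_hasDerivAt_right (pA_int t ht.le)
  · exact (pA_contOn.mono Ioi_subset_Ici_self).stronglyMeasurableAtFilter isOpen_Ioi t ht
  · exact (pA_hasDeriv ht).continuousAt

lemma pO_nonneg {t : ℝ} (ht : 0 ≤ t) : 0 ≤ pO t :=
  intervalIntegral.integral_nonneg ht fun s hs => pA_nonneg hs.1

lemma pO_le {t : ℝ} (ht : 0 ≤ t) : pO t ≤ t^3/12 := by
  have h : pO t ≤ ∫ s in (0:ℝ)..t, s^2/4 := by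
    apply intervalIntegral.integral_mono_on ht (pA_int t ht)
      (Continuous.intervalIntegrable (by fun_prop) _ _)
    exact fun s hs => pA_le hs.1
  refine h.trans_eq ?_
  simp
  ring

lemma pO_contOn : ContinuousOn pO (Ici 0) := by
  intro x hx
  rcases eq_or_lt_of_le (show (0:ℝ) ≤ x from hx) with rfl | hx
  · have h0 : pO 0 = 0 := by simp [pO]
    rw [ContinuousWithinAt, h0]
    refine tendsto_of_tendsto_of_tendsto_of_le_of_le' tendsto_const_nhds (h := fun t => t^3/12) ?_
      (eventually_mem_nhdsWithin.mono fun t ht => pO_nonneg ht)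
      (eventually_mem_nhdsWithin.mono fun t ht => pO_le ht)
    have : ContinuousWithinAt (fun t : ℝ => t^3/12) (Ici 0) 0 := by fun_prop
    simpa [ContinuousWithinAt] using this
  · exact (pO_hasDeriv hx).continuousAt.continuousWithinAt

lemma pA_ge {t : ℝ} (ht : 0 ≤ t) :
    t^2/4 - t + 5/4 - (1+t)*exp (-t) - (t/2+1/4)*exp (-t)^2 ≤ pA t := by
  have hmono : MonotoneOn (fun t => pA t - (t^2/4 - t + 5/4 - (1+t)*exp (-t) - (t/2+1/4)*exp (-t)^2)) (Ici 0) := by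
    have hd : ∀ x : ℝ, 0 < x → HasDerivAt (fun t => pA t - (t^2/4 - t + 5/4 - (1+t)*exp (-t) - (t/2+1/4)*exp (-t)^2))
        (pB x - (x/2 - 1 + x * exp (-x) + x * exp (-x)^2)) x := by
      intro x hx
      have he : HasDerivAt (fun t : ℝ => exp (-t)) (-exp (-x)) x := by
        simpa using (hasDerivAt_neg x).exp
      have h := (pA_hasDeriv hx).sub ((((((hasDerivAt_id x).pow 2).div_const 4).sub (hasDerivAt_id x)).add_const (5/4)).sub
        (((hasDerivAt_id x).const_add 1).mul he) |>.sub
        ((((hasDerivAt_id x).div_const 2).add_const (1/4)).mul (he.pow 2)))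
      refine h.congr_deriv ?_
      simp only [id, Pi.pow_apply]
      ring
    apply monotoneOn_of_deriv_nonneg (convex_Ici _)
    · have := pA_contOn
      fun_prop
    · intro x hx
      rw [interior_Ici] at hx
      exact (hd x hx).differentiableAt.differentiableWithinAt
    · intro x hx
      rw [interior_Ici] at hx
      rw [(hd x hx).deriv]
      have hz := exp_sub_pos hx
      have hx' : (0:ℝ) < x := hx
      have e1 : pB x - (x/2 - 1 + x * exp (-x) + x * exp (-x)^2) = x * (1/ (exp x - 1) - exp (-x) - exp (-x)^2) := by
        unfold pB; ring
      rw [e1]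
      apply mul_nonneg hx'.le
      rw [exp_neg]
      have hp := exp_pos x
      have : 1/ (exp x - 1) - (exp x)⁻¹ - (exp x)⁻¹^2 = 1 / ((exp x - 1) * exp x ^2) := by
        field_simp; ring
      rw [this]
      positivity
  have h := hmono (show (0:ℝ) ∈ Ici (0:ℝ) by simp) (show t ∈ Ici (0:ℝ) from ht) ht
  have h0 : pA 0 = 0 := by simp [pA]
  simp [h0] at h
  norm_num at h
  simpa using h

lemma pA_ge_lin {t : ℝ} (ht : 0 ≤ t) (hz : 5.8 ≤ exp t) : 2*t - 7.85 ≤ pA t := by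
  refine le_trans ?_ (pA_ge ht)
  set u := exp (-t) with hu
  have hup : 0 < u := exp_pos _
  have huz : u * exp t = 1 := by rw [hu, ← exp_add]; simp
  have hu1 : u ≤ 1/5 := by nlinarith
  have hE : 1 + t + t^2/2 + t^3/6 + t^4/24 ≤ exp t := by
    have := Real.sum_le_exp_of_nonneg ht 5
    simp [Finset.sum_range_succ, Nat.factorial] at this
    linarith
  have hpoly : 1.1 * (1+t) ≤ ((t-6)^2/4 + 0.1) * (1 + t + t^2/2 + t^3/6 + t^4/24) := by
    set S := 1 + t + t^2/2 + t^3/6 + t^4/24 with hS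
    have hS0 : 1 + t ≤ S := by
      have : 0 ≤ t^2/2 + t^3/6 + t^4/24 := by positivity
      linarith
    rcases le_total t 4 with h4 | h4
    · have : 1 ≤ (t-6)^2/4 := by nlinarith
      nlinarith
    have q2 : 16 ≤ t^2 := by nlinarith
    have q3 : 64 ≤ t^3 := by nlinarith
    have q4 : 256 ≤ t^4 := by nlinarith
    rcases le_total t 5.1 with h5 | h5
    · have : 0.2 ≤ (t-6)^2/4 := by nlinarith
      have : 34 ≤ S := by linarith
      nlinarith
    · have r2 : 5.1 * t ≤ t^2 := by nlinarith
      have r3 : 26 * t ≤ t^3 := by nlinarith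
      have r4 : 132 * t ≤ t^4 := by nlinarith
      have : 11 * (1 + t) ≤ S := by linarith
      nlinarith [sq_nonneg (t-6)]
  have h1 : 1.1 * (1+t) * u ≤ ((t-6)^2/4 + 0.1) := by
    have : ((t-6)^2/4 + 0.1) * (1 + t + t^2/2 + t^3/6 + t^4/24) ≤ ((t-6)^2/4 + 0.1) * exp t := by
      gcongr
    have h3 : 1.1 * (1+t) * u ≤ (((t-6)^2/4 + 0.1) * exp t) * u := by
      apply mul_le_mul_of_nonneg_right _ hup.le
      linarith
    rw [mul_assoc _ (exp t), mul_comm (exp t), huz, mul_one] at h3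
    exact h3
  have h2 : (t/2+1/4)*u^2 ≤ 0.1 * (1+t) * u := by
    have : (t/2+1/4) * u ≤ (1+t)/2 * (1/5) := by
      apply mul_le_mul _ hu1 hup.le (by linarith)
      linarith
    nlinarith
  nlinarith

/-- The function whose sign is the sign of the fourth derivative. -/
noncomputable def gF (t : ℝ) : ℝ :=
  pO t + (-4 * ((exp t ^2 + 4 * exp t + 1) * (exp t - 1)) * pA t
   + (exp t - 1) * (t * (4 * exp t ^2 + 11 * exp t + 3) - 2 * (exp t - 1) * (5 * exp t + 4))) /
    (exp t ^3 + 11 * exp t ^2 + 11 * exp t + 1)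

lemma gF_deriv {t : ℝ} (ht : 0 < t) : HasDerivAt gF
    (((exp t - 1)^4 * (exp t ^2 - 6 * exp t + 1) * pA t +
      ((exp t - 1) * (7 + 10 * exp t + 88 * exp t^2 + 38 * exp t^3 - 7 * exp t^4 + 8 * exp t^5)
        - t * (2 + 7 * exp t + 62 * exp t^2 + 38 * exp t^3 + 38 * exp t^4 - 5 * exp t^5 + 2 * exp t^6)))
      / (exp t ^3 + 11 * exp t ^2 + 11 * exp t + 1)^2) t := by
  have hz := exp_sub_pos ht
  have hzp := exp_pos t
  have e := hasDerivAt_exp t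
  have i := hasDerivAt_id t
  have hW : exp t ^3 + 11 * exp t ^2 + 11 * exp t + 1 ≠ 0 := by positivity
  have h := (pO_hasDeriv ht).add ((((((((e.pow 2).add (e.const_mul 4)).add_const 1).mul (e.sub_const 1)).const_mul (-4)).mul
    (pA_hasDeriv ht)).add ((e.sub_const 1).mul ((i.mul ((((e.pow 2).const_mul 4).add (e.const_mul 11)).add_const 3)).sub
     (((e.sub_const 1).const_mul 2).mul ((e.const_mul 5).add_const 4))))).div
     (((((e.pow 3)).add ((e.pow 2).const_mul 11)).add (e.const_mul 11)).add_const 1) hW)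
  refine h.congr_deriv ?_
  simp only [id, Pi.sub_apply, Pi.pow_apply, Pi.mul_apply, Pi.add_apply]
  unfold pB
  generalize exp t = z at *
  field_simp
  ring

lemma gF_deriv_nonneg {t : ℝ} (ht : 0 < t) : 0 ≤
    (exp t - 1)^4 * (exp t ^2 - 6 * exp t + 1) * pA t +
      ((exp t - 1) * (7 + 10 * exp t + 88 * exp t^2 + 38 * exp t^3 - 7 * exp t^4 + 8 * exp t^5)
        - t * (2 + 7 * exp t + 62 * exp t^2 + 38 * exp t^3 + 38 * exp t^4 - 5 * exp t^5 + 2 * exp t^6)) := by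
  have hz := exp_sub_pos ht
  rcases le_total (exp t ^2 - 6 * exp t + 1) 0 with hc | hc
  · have h6 : exp t ≤ 6 := by nlinarith
    have hB := log_le_B (exp t) (by linarith) h6
    rw [log_exp] at hB
    have ht2 : t ≤ 2 := by
      by_contra! h
      have h1 : exp 2 ≤ exp t := exp_le_exp.2 h.le
      have h2 := Real.sum_le_exp_of_nonneg (show (0:ℝ) ≤ 2 by norm_num) 5
      simp [Finset.sum_range_succ, Nat.factorial] at h2
      norm_num at h2
      linarith
    have hp1 : pA t ≤ 1 := (pA_le ht.le).trans (by nlinarith)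
    have h4 : (exp t - 1)^4 * (exp t ^2 - 6 * exp t + 1) ≤ 0 :=
      mul_nonpos_of_nonneg_of_nonpos (by positivity) hc
    have h5 : (exp t - 1)^4 * (exp t ^2 - 6 * exp t + 1) * 1 ≤ (exp t - 1)^4 * (exp t ^2 - 6 * exp t + 1) * pA t :=
      mul_le_mul_of_nonpos_left hp1 h4
    generalize exp t = z at *
    linarith
  · have h6 : 5.8 ≤ exp t := by nlinarith
    have hA := log_le_A (exp t) h6
    rw [log_exp] at hA
    have hp1 := pA_ge_lin ht.le h6
    have h5 : (exp t - 1)^4 * (exp t ^2 - 6 * exp t + 1) * (2*t - 7.85) ≤ (exp t - 1)^4 * (exp t ^2 - 6 * exp t + 1) * pA t := by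
      gcongr
    generalize exp t = z at *
    linarith

lemma gF_nonneg {t : ℝ} (ht : 0 < t) : 0 ≤ gF t := by
  have hm : MonotoneOn gF (Ici 0) := by
    apply monotoneOn_of_deriv_nonneg (convex_Ici _)
    · have h1 := pO_contOn
      have h2 := pA_contOn
      have h3 : ∀ t ∈ Ici (0:ℝ), exp t ^3 + 11 * exp t ^2 + 11 * exp t + 1 ≠ 0 := fun t _ => by positivity
      unfold gF
      fun_prop (disch := assumption)
    · intro x hx
      rw [interior_Ici] at hx
      exact (gF_deriv hx).differentiableAt.differentiableWithinAt
    · intro x hx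
      rw [interior_Ici] at hx
      rw [(gF_deriv hx).deriv]
      exact div_nonneg (gF_deriv_nonneg hx) (by positivity)
  have h := hm (show (0:ℝ) ∈ Ici (0:ℝ) by simp) (show t ∈ Ici (0:ℝ) from ht.le) ht.le
  simpa [gF, pO, pA] using h

noncomputable def aO (t : ℝ) : ℝ := exp t / (exp t - 1)
noncomputable def aA (t : ℝ) : ℝ := -(exp t / (exp t - 1)^2)
noncomputable def aB (t : ℝ) : ℝ := exp t * (exp t + 1) / (exp t - 1)^3
noncomputable def aC (t : ℝ) : ℝ := -(exp t * (exp t ^2 + 4 * exp t + 1) / (exp t - 1)^4)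
noncomputable def aD (t : ℝ) : ℝ :=
  exp t * (exp t ^3 + 11 * exp t ^2 + 11 * exp t + 1) / (exp t - 1)^5

lemma aO_hasDeriv {t : ℝ} (ht : 0 < t) : HasDerivAt aO (aA t) t := by
  have hz := exp_sub_pos ht
  have e := hasDerivAt_exp t
  refine (e.div (e.sub_const 1) hz.ne').congr_deriv ?_
  unfold aA
  field_simp
  ring

lemma aA_hasDeriv {t : ℝ} (ht : 0 < t) : HasDerivAt aA (aB t) t := by
  have hz := exp_sub_pos ht
  have e := hasDerivAt_exp t
  refine (e.div ((e.sub_const 1).pow 2) (pow_ne_zero 2 hz.ne')).neg.congr_deriv ?_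
  unfold aB
  simp only [Pi.pow_apply]
  field_simp
  ring

lemma aB_hasDeriv {t : ℝ} (ht : 0 < t) : HasDerivAt aB (aC t) t := by
  have hz := exp_sub_pos ht
  have e := hasDerivAt_exp t
  refine ((e.mul (e.add_const 1)).div ((e.sub_const 1).pow 3) (pow_ne_zero 3 hz.ne')).congr_deriv ?_
  unfold aC
  simp only [Pi.pow_apply, Pi.mul_apply]
  field_simp
  ring

lemma aC_hasDeriv {t : ℝ} (ht : 0 < t) : HasDerivAt aC (aD t) t := by
  have hz := exp_sub_pos ht
  have e := hasDerivAt_exp t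
  refine ((e.mul (((e.pow 2).add (e.const_mul 4)).add_const 1)).div ((e.sub_const 1).pow 4)
    (pow_ne_zero 4 hz.ne')).neg.congr_deriv ?_
  unfold aD
  simp only [Pi.pow_apply, Pi.mul_apply, Pi.add_apply]
  field_simp
  ring

noncomputable def qO (t : ℝ) : ℝ := 2 * (aO t * pO t)
noncomputable def qA (t : ℝ) : ℝ := 2 * (aO t * pA t + aA t * pO t)
noncomputable def qB (t : ℝ) : ℝ := 2 * (aO t * pB t + 2 * (aA t * pA t) + aB t * pO t)
noncomputable def qC (t : ℝ) : ℝ :=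
  2 * (aO t * pC t + 3 * (aA t * pB t) + 3 * (aB t * pA t) + aC t * pO t)
noncomputable def qD (t : ℝ) : ℝ :=
  2 * (aO t * pD t + 4 * (aA t * pC t) + 6 * (aB t * pB t) + 4 * (aC t * pA t) + aD t * pO t)

lemma qO_hasDeriv {t : ℝ} (ht : 0 < t) : HasDerivAt qO (qA t) t := by
  refine (((aO_hasDeriv ht).mul (pO_hasDeriv ht)).const_mul 2).congr_deriv ?_
  unfold qA; ring

lemma qA_hasDeriv {t : ℝ} (ht : 0 < t) : HasDerivAt qA (qB t) t := by
  refine ((((aO_hasDeriv ht).mul (pA_hasDeriv ht)).add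
    ((aA_hasDeriv ht).mul (pO_hasDeriv ht))).const_mul 2).congr_deriv ?_
  unfold qB; ring

lemma qB_hasDeriv {t : ℝ} (ht : 0 < t) : HasDerivAt qB (qC t) t := by
  refine (((((aO_hasDeriv ht).mul (pB_hasDeriv ht)).add
    (((aA_hasDeriv ht).mul (pA_hasDeriv ht)).const_mul 2)).add
    ((aB_hasDeriv ht).mul (pO_hasDeriv ht))).const_mul 2).congr_deriv ?_
  unfold qC; ring

lemma qC_hasDeriv {t : ℝ} (ht : 0 < t) : HasDerivAt qC (qD t) t := by
  refine ((((((aO_hasDeriv ht).mul (pC_hasDeriv ht)).add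
    (((aA_hasDeriv ht).mul (pB_hasDeriv ht)).const_mul 3)).add
    (((aB_hasDeriv ht).mul (pA_hasDeriv ht)).const_mul 3)).add
    ((aC_hasDeriv ht).mul (pO_hasDeriv ht))).const_mul 2).congr_deriv ?_
  unfold qD; ring

lemma qD_nonneg {t : ℝ} (ht : 0 < t) : 0 ≤ qD t := by
  have hz := exp_sub_pos ht
  have hzp := exp_pos t
  have hW : exp t ^3 + 11 * exp t ^2 + 11 * exp t + 1 ≠ 0 := by positivity
  have h : qD t = 2 * aD t * gF t := by
    unfold qD aO aA aB aC aD gF pB pC pD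
    generalize exp t = z at *
    field_simp
    ring
  rw [h]
  have : 0 ≤ aD t := by unfold aD; positivity
  exact mul_nonneg (by positivity) (gF_nonneg ht)

end CMaux
end

section
open Real Set Filter Topology MeasureTheory

namespace CMaux

noncomputable def Lap (g : ℝ → ℝ) (x : ℝ) : ℝ := ∫ t in Ioi (0:ℝ), exp (-(x*t)) * g t

def LapInt (g : ℝ → ℝ) : Prop :=
  ∀ x : ℝ, 0 < x → IntegrableOn (fun t => exp (-(x*t)) * g t) (Ioi 0)

lemma pow_exp_int (k : ℕ) {x : ℝ} (hx : 0 < x) :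
    IntegrableOn (fun t : ℝ => exp (-(x*t)) * t^k) (Ioi 0) := by
  have h := integrableOn_rpow_mul_exp_neg_mul_rpow (p := 1) (s := k) (b := x)
    (by have : (0:ℝ) ≤ k := by positivity
        linarith) one_pos hx
  refine h.congr_fun (fun t ht => ?_) measurableSet_Ioi
  simp only [rpow_natCast, rpow_one]
  rw [mul_comm, neg_mul]

lemma Lap_pow (k : ℕ) {x : ℝ} (hx : 0 < x) :
    Lap (fun t => t^k) x = (k.factorial : ℝ) / x^(k+1) := by
  have h := integral_rpow_mul_exp_neg_mul_Ioi (a := k + 1) (r := x) (by positivity) hx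
  rw [Gamma_nat_eq_factorial] at h
  unfold Lap
  rw [show ((k:ℝ)+1) = ((k+1 : ℕ):ℝ) by push_cast; ring, rpow_natCast] at h
  rw [div_eq_mul_inv, mul_comm, ← inv_pow, ← one_div, ← h]
  refine setIntegral_congr_fun measurableSet_Ioi (fun t ht => ?_)
  simp [mul_comm]

lemma LapInt_pow (k : ℕ) : LapInt (fun t => t^k) := fun _ hx => pow_exp_int k hx

lemma LapInt_of_bound {g : ℝ → ℝ} (hc : ContinuousOn g (Ioi 0)) (M : ℝ)
    (hb : ∀ t, 0 < t → |g t| ≤ M * (1 + t^4)) : LapInt g := by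
  intro x hx
  have h1 : IntegrableOn (fun t : ℝ => M * (exp (-(x*t)) * t^0 + exp (-(x*t)) * t^4)) (Ioi 0) :=
    ((pow_exp_int 0 hx).add (pow_exp_int 4 hx)).const_mul M
  refine Integrable.mono' h1 ?_ ?_
  · exact (ContinuousOn.mul (by fun_prop) hc).aestronglyMeasurable measurableSet_Ioi
  · refine (ae_restrict_iff' measurableSet_Ioi).2 (Eventually.of_forall fun t ht => ?_)
    rw [norm_mul, norm_eq_abs, norm_eq_abs, abs_of_pos (exp_pos _)]
    have := mul_le_mul_of_nonneg_left (hb t ht) (exp_pos (-(x*t))).le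
    linarith

lemma Lap_add {f g : ℝ → ℝ} (hf : LapInt f) (hg : LapInt g) {x : ℝ} (hx : 0 < x) :
    Lap (fun t => f t + g t) x = Lap f x + Lap g x := by
  unfold Lap
  rw [← integral_add (hf x hx) (hg x hx)]
  simp only [mul_add]

lemma Lap_const_mul (c : ℝ) (g : ℝ → ℝ) (x : ℝ) :
    Lap (fun t => c * g t) x = c * Lap g x := by
  unfold Lap
  rw [← integral_const_mul]
  simp only [mul_left_comm]

lemma Lap_congr {f g : ℝ → ℝ} (h : ∀ t, 0 < t → f t = g t) (x : ℝ) : Lap f x = Lap g x :=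
  setIntegral_congr_fun measurableSet_Ioi (fun t ht => by simp only [h t ht])

lemma Lap_diff {g : ℝ → ℝ} (hg : LapInt g) {x : ℝ} (hx : 0 < x) :
    Lap g x - Lap g (x+1) = Lap (fun t => g t * (1 - exp (-t))) x := by
  unfold Lap
  rw [← integral_sub (hg x hx) (hg (x+1) (by linarith))]
  refine setIntegral_congr_fun measurableSet_Ioi (fun t ht => ?_)
  simp only
  rw [show -((x+1)*t) = -(x*t) + -t by ring, exp_add]
  ring

lemma Lap_nonneg {g : ℝ → ℝ} (h : ∀ t, 0 < t → 0 ≤ g t) (x : ℝ) : 0 ≤ Lap g x :=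
  setIntegral_nonneg measurableSet_Ioi fun t ht => mul_nonneg (exp_pos _).le (h t ht)

lemma Lap_anti {g : ℝ → ℝ} (hg : LapInt g) (h : ∀ t, 0 < t → 0 ≤ g t) {x y : ℝ} (hx : 0 < x)
    (hxy : x ≤ y) : Lap g y ≤ Lap g x := by
  apply setIntegral_mono_on (hg y (by linarith)) (hg x hx) measurableSet_Ioi
  intro t ht
  have ht' : (0:ℝ) < t := ht
  have := h t ht
  gcongr

lemma Lap_tendsto {g : ℝ → ℝ} (hg : LapInt g) {x : ℝ} (hx : 0 < x) :
    Tendsto (fun n : ℕ => Lap g (x + n)) atTop (𝓝 0) := by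
  have : (0:ℝ) = ∫ t in Ioi (0:ℝ), (0:ℝ) := by simp
  rw [this]
  refine tendsto_integral_of_dominated_convergence (fun t => ‖exp (-(x*t)) * g t‖) ?_ ?_ ?_ ?_
  · exact fun n => (hg (x+n) (by positivity)).aestronglyMeasurable
  · exact (hg x hx).norm
  · intro n
    refine (ae_restrict_iff' measurableSet_Ioi).2 (Eventually.of_forall fun t ht => ?_)
    have ht' : (0:ℝ) < t := ht
    rw [norm_mul, norm_mul, norm_eq_abs, norm_eq_abs (exp (-(x*t))), abs_of_pos (exp_pos _), abs_of_pos (exp_pos _)]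
    gcongr
    have : (0:ℝ) ≤ n := by positivity
    linarith
  · refine (ae_restrict_iff' measurableSet_Ioi).2 (Eventually.of_forall fun t ht => ?_)
    have ht' : (0:ℝ) < t := ht
    have h1 : Tendsto (fun n : ℕ => exp (-((x+n)*t))) atTop (𝓝 0) := by
      apply tendsto_exp_neg_atTop_nhds_zero.comp
      apply Tendsto.atTop_mul_const ht'
      exact tendsto_atTop_add_const_left _ _ tendsto_natCast_atTop_atTop
    simpa using h1.mul_const (g t)

section mgf
open ProbabilityTheory

noncomputable def lapMeas (g : ℝ → ℝ) : Measure ℝ :=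
  (volume.restrict (Ioi (0:ℝ))).withDensity (fun t => ENNReal.ofReal (g t))

lemma LapInt.aemeas {g : ℝ → ℝ} (hg : LapInt g) :
    AEMeasurable (fun t => ENNReal.ofReal (g t)) (volume.restrict (Ioi (0:ℝ))) := by
  apply AEMeasurable.ennreal_ofReal
  have h1 := (hg 1 one_pos).aestronglyMeasurable.aemeasurable
  have h2 : AEMeasurable (fun t : ℝ => exp t) (volume.restrict (Ioi (0:ℝ))) := by fun_prop
  refine (h2.mul h1).congr (Eventually.of_forall fun t => ?_)
  simp only [Pi.mul_apply, one_mul]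
  rw [← mul_assoc, ← exp_add]; simp

lemma lapMeas_integral {g : ℝ → ℝ} (hg : LapInt g) (h0 : ∀ t, 0 < t → 0 ≤ g t) (f : ℝ → ℝ) :
    ∫ t, f t ∂(lapMeas g) = ∫ t in Ioi (0:ℝ), f t * g t := by
  unfold lapMeas
  rw [integral_withDensity_eq_integral_toReal_smul₀ hg.aemeas (by simp)]
  refine setIntegral_congr_fun measurableSet_Ioi (fun t ht => ?_)
  simp only [ENNReal.toReal_ofReal (h0 t ht), smul_eq_mul, mul_comm]

lemma lapMeas_mem {g : ℝ → ℝ} (hg : LapInt g) (h0 : ∀ t, 0 < t → 0 ≤ g t) {x : ℝ} (hx : 0 < x) :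
    x ∈ interior (integrableExpSet (fun t => -t) (lapMeas g)) := by
  rw [mem_interior]
  refine ⟨Ioi 0, fun y hy => ?_, isOpen_Ioi, hx⟩
  show Integrable _ _
  unfold lapMeas
  rw [integrable_withDensity_iff_integrable_smul₀' hg.aemeas (by simp)]
  refine IntegrableOn.congr_fun (hg y hy) (fun t ht => ?_) measurableSet_Ioi
  simp only [ENNReal.toReal_ofReal (h0 t ht), smul_eq_mul, mul_comm, mul_neg]

lemma Lap_eq_mgf {g : ℝ → ℝ} (hg : LapInt g) (h0 : ∀ t, 0 < t → 0 ≤ g t) :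
    Lap g = mgf (fun t => -t) (lapMeas g) := by
  ext x
  unfold mgf
  rw [lapMeas_integral hg h0]
  simp [Lap]

lemma Lap_iteratedDeriv {g : ℝ → ℝ} (hg : LapInt g) (h0 : ∀ t, 0 < t → 0 ≤ g t) {x : ℝ}
    (hx : 0 < x) (n : ℕ) :
    iteratedDeriv n (Lap g) x = (-1)^n * Lap (fun t => t^n * g t) x := by
  rw [Lap_eq_mgf hg h0, iteratedDeriv_mgf (lapMeas_mem hg h0 hx), lapMeas_integral hg h0, Lap,
    ← integral_const_mul]
  congr 1
  ext t
  rw [neg_pow, mul_neg]; ring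

lemma Lap_hasDeriv {g : ℝ → ℝ} (hg : LapInt g) (h0 : ∀ t, 0 < t → 0 ≤ g t) {x : ℝ}
    (hx : 0 < x) : HasDerivAt (Lap g) (- Lap (fun t => t * g t) x) x := by
  have h := hasDerivAt_mgf (lapMeas_mem hg h0 hx)
  rw [← Lap_eq_mgf hg h0, lapMeas_integral hg h0] at h
  refine h.congr_deriv ?_
  rw [Lap, ← integral_neg]
  congr 1
  ext t
  rw [mul_neg]; ring

end mgf

/-- integration by parts -/
lemma Lap_ibp {H h : ℝ → ℝ} (hc : ContinuousWithinAt H (Ici 0) 0) (h00 : H 0 = 0)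
    (hd : ∀ t, 0 < t → HasDerivAt H (h t) t) (hH : LapInt H) (hh : LapInt h)
    {x : ℝ} (hx : 0 < x) (hlim : Tendsto (fun t => exp (-(x*t)) * H t) atTop (𝓝 0)) :
    x * Lap H x = Lap h x := by
  have h1 := integral_Ioi_of_hasDerivAt_of_tendsto (a := 0) (m := 0)
    (f := fun t => exp (-(x*t)) * H t) (f' := fun t => exp (-(x*t)) * h t - x * (exp (-(x*t)) * H t))
    (ContinuousWithinAt.mul (by fun_prop) hc) (fun t ht => ?_) ?_ hlim
  · rw [integral_sub (hh x hx) ((hH x hx).const_mul x), integral_const_mul] at h1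
    simp only [h00] at h1
    unfold Lap
    linarith
  · have e : HasDerivAt (fun t : ℝ => exp (-(x*t))) (exp (-(x*t)) * (-(x*1))) t :=
      (((hasDerivAt_id t).const_mul x).neg).exp
    refine (e.mul (hd t ht)).congr_deriv ?_
    ring
  · exact (hh x hx).sub ((hH x hx).const_mul x)

lemma exp_poly_lim (k : ℕ) {x : ℝ} (hx : 0 < x) :
    Tendsto (fun t : ℝ => exp (-(x*t)) * t^k) atTop (𝓝 0) := by
  have := tendsto_rpow_mul_exp_neg_mul_atTop_nhds_zero k x hx
  refine this.congr fun t => ?_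
  rw [rpow_natCast, mul_comm, neg_mul]

lemma exp_lim_of_bound {H : ℝ → ℝ} (k : ℕ) (M : ℝ) (hb : ∀ t, 0 < t → |H t| ≤ M * t^k) {x : ℝ}
    (hx : 0 < x) : Tendsto (fun t => exp (-(x*t)) * H t) atTop (𝓝 0) := by
  have h1 := (exp_poly_lim k hx).const_mul M
  rw [mul_zero] at h1
  refine squeeze_zero_norm' ?_ h1
  filter_upwards [eventually_gt_atTop 0] with t ht
  rw [norm_mul, norm_eq_abs, norm_eq_abs, abs_of_pos (exp_pos _)]
  have := mul_le_mul_of_nonneg_left (hb t ht) (exp_pos (-(x*t))).le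
  linarith

end CMaux
end

section
open Real Set Filter Topology MeasureTheory

namespace CMaux

noncomputable def dl (t : ℝ) : ℝ := t * aO t

lemma dl_nonneg {t : ℝ} (ht : 0 < t) : 0 ≤ dl t := by
  have := exp_sub_pos ht
  unfold dl aO; positivity

lemma dl_le {t : ℝ} (ht : 0 < t) : dl t ≤ 1 + t := by
  have := exp_sub_pos ht
  unfold dl aO
  rw [← mul_div_assoc, div_le_iff₀ this]
  linarith [add_one_le_exp t]

lemma dl_eq {t : ℝ} (ht : 0 < t) : dl t = pB t + 1 + t/2 := by
  have := exp_sub_pos ht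
  unfold dl aO pB; field_simp; ring

lemma dl_mul {t : ℝ} (ht : 0 < t) : dl t * (1 - exp (-t)) = t := by
  have := exp_sub_pos ht
  unfold dl aO; rw [exp_neg]; field_simp

lemma dl_cont : ContinuousOn dl (Ioi 0) := by
  intro t ht
  exact ((continuousAt_id).mul (aO_hasDeriv ht).continuousAt).continuousWithinAt

lemma dl_int : LapInt dl := by
  refine LapInt_of_bound dl_cont 2 (fun t ht => ?_)
  rw [abs_of_nonneg (dl_nonneg ht)]
  nlinarith [dl_le ht, sq_nonneg (t^2 - 1), sq_nonneg (t-1)]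

lemma tdl_int : LapInt (fun t => t * dl t) := by
  refine LapInt_of_bound (continuousOn_id.mul dl_cont) 2 (fun t ht => ?_)
  rw [abs_of_nonneg (mul_nonneg ht.le (dl_nonneg ht))]
  nlinarith [mul_le_mul_of_nonneg_left (dl_le ht) ht.le, sq_nonneg (t^2 - 1), sq_nonneg (t-1)]

noncomputable def ph : ℝ → ℝ := Lap dl

lemma ph_hasDeriv {x : ℝ} (hx : 0 < x) : HasDerivAt ph (-Lap (fun t => t * dl t) x) x :=
  Lap_hasDeriv dl_int (fun _ => dl_nonneg) hx

lemma ph_cont : ContinuousOn ph (Ioi 0) := fun _ hx => (ph_hasDeriv hx).continuousAt.continuousWithinAt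

lemma ph_diff {x : ℝ} (hx : 0 < x) : ph x - ph (x+1) = 1/x^2 := by
  unfold ph
  rw [Lap_diff dl_int hx, Lap_congr (g := fun t => t^1) (fun t ht => by rw [dl_mul ht]; simp),
    Lap_pow 1 hx]
  norm_num

lemma ftc {f : ℝ → ℝ} (hc : ContinuousOn f (Ioi 0)) {x : ℝ} (hx : 0 < x) :
    HasDerivAt (fun x => ∫ s in (1:ℝ)..x, f s) (f x) x := by
  apply intervalIntegral.integral_hasDerivAt_right
  · apply ContinuousOn.intervalIntegrable
    apply hc.mono
    intro y hy
    have := hy.1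
    exact lt_of_lt_of_le (lt_min one_pos hx) this
  · exact ContinuousOn.stronglyMeasurableAtFilter isOpen_Ioi hc x hx
  · exact hc.continuousAt (Ioi_mem_nhds hx)

lemma const_of_deriv {g : ℝ → ℝ} (h : ∀ x, 0 < x → HasDerivAt g 0 x) {x y : ℝ} (hx : 0 < x) (hy : 0 < y) :
    g x = g y := by
  apply isOpen_Ioi.is_const_of_deriv_eq_zero (s := Ioi (0:ℝ)) isPreconnected_Ioi
    (fun z hz => (h z hz).differentiableAt.differentiableWithinAt)
    (fun z hz => (h z hz).deriv) hx hy

noncomputable def Ph (x : ℝ) : ℝ := ∫ s in (1:ℝ)..x, ph s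

lemma Ph_hasDeriv {x : ℝ} (hx : 0 < x) : HasDerivAt Ph (ph x) x := ftc ph_cont hx
lemma Ph_cont : ContinuousOn Ph (Ioi 0) := fun _ hx => (Ph_hasDeriv hx).continuousAt.continuousWithinAt

lemma shift_deriv {f : ℝ → ℝ} {f' x : ℝ} (h : HasDerivAt f f' (x+1)) :
    HasDerivAt (fun x => f (x+1)) f' x := HasDerivAt.comp_add_const x 1 h

lemma Ph_diff {x : ℝ} (hx : 0 < x) : Ph (x+1) - Ph x = 1/x := by
  have hd : ∀ x : ℝ, 0 < x → HasDerivAt (fun x => Ph (x+1) - Ph x - x⁻¹) 0 x := by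
    intro x hx
    have h := ((shift_deriv (Ph_hasDeriv (x := x+1) (by linarith))).sub (Ph_hasDeriv hx)).sub
      (hasDerivAt_inv hx.ne')
    refine h.congr_deriv ?_
    have := ph_diff hx
    rw [one_div] at this
    linarith
  have hc : ∀ n : ℕ, Ph (x + n + 1) - Ph (x+n) - (x+n)⁻¹ = Ph (x+1) - Ph x - x⁻¹ := fun n =>
    const_of_deriv hd (x := x+n) (by positivity) hx
  have hb : ∀ n : ℕ, Ph (x + n + 1) - Ph (x+n) ∈ Icc 0 (ph (x+n)) := by
    intro n
    have hn : 0 < x + n := by positivity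
    obtain ⟨c, hc, he⟩ := exists_hasDerivAt_eq_slope Ph ph (show x+n < x+n+1 by linarith)
      (Ph_cont.mono fun y hy => lt_of_lt_of_le hn hy.1)
      (fun y hy => Ph_hasDeriv (hn.trans hy.1))
    have : Ph (x + n + 1) - Ph (x+n) = ph c := by rw [he]; simp
    rw [this]
    exact ⟨Lap_nonneg (fun _ => dl_nonneg) _, Lap_anti dl_int (fun _ => dl_nonneg) hn hc.1.le⟩
  have h1 : Tendsto (fun n : ℕ => Ph (x + n + 1) - Ph (x+n)) atTop (𝓝 0) :=
    squeeze_zero (fun n => (hb n).1) (fun n => (hb n).2) (Lap_tendsto dl_int hx)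
  have h2 : Tendsto (fun n : ℕ => (x+n)⁻¹) atTop (𝓝 0) :=
    tendsto_inv_atTop_zero.comp (tendsto_atTop_add_const_left _ _ tendsto_natCast_atTop_atTop)
  have h3 := h1.sub h2
  simp only [hc, sub_zero] at h3
  have := tendsto_nhds_unique h3 tendsto_const_nhds
  rw [one_div]; linarith

noncomputable def L0 (x : ℝ) : ℝ := ∫ s in (1:ℝ)..x, Ph s
lemma L0_hasDeriv {x : ℝ} (hx : 0 < x) : HasDerivAt L0 (Ph x) x := ftc Ph_cont hx

lemma L0_diff {x : ℝ} (hx : 0 < x) : L0 (x+1) - L0 x = log x + L0 2 := by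
  have hd : ∀ x : ℝ, 0 < x → HasDerivAt (fun x => L0 (x+1) - L0 x - log x) 0 x := by
    intro x hx
    have h := ((shift_deriv (L0_hasDeriv (x := x+1) (by linarith))).sub (L0_hasDeriv hx)).sub
      (hasDerivAt_log hx.ne')
    refine h.congr_deriv ?_
    rw [Ph_diff hx]; simp
  have := const_of_deriv hd hx one_pos
  have h1 : L0 1 = 0 := by simp [L0]
  norm_num [h1] at this
  linarith

noncomputable def Lg (x : ℝ) : ℝ := L0 x - L0 2 * (x-1)
lemma Lg_hasDeriv {x : ℝ} (hx : 0 < x) : HasDerivAt Lg (Ph x - L0 2) x := by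
  have := (L0_hasDeriv hx).sub (((hasDerivAt_id x).sub_const 1).const_mul (L0 2))
  exact this.congr_deriv (by simp)

lemma Lg_convex : ConvexOn ℝ (Ioi 0) Lg := by
  apply MonotoneOn.convexOn_of_deriv (convex_Ioi 0)
  · exact fun x hx => (Lg_hasDeriv hx).continuousAt.continuousWithinAt
  · rw [interior_Ioi]
    exact fun x hx => (Lg_hasDeriv hx).differentiableAt.differentiableWithinAt
  · rw [interior_Ioi]
    have h : MonotoneOn (fun x => Ph x - L0 2) (Ioi 0) := by
      apply monotoneOn_of_deriv_nonneg (convex_Ioi _)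
      · exact fun x hx => ((Ph_hasDeriv hx).sub_const _).continuousAt.continuousWithinAt
      · rw [interior_Ioi]
        exact fun x hx => ((Ph_hasDeriv hx).sub_const _).differentiableAt.differentiableWithinAt
      · rw [interior_Ioi]
        intro x hx
        rw [((Ph_hasDeriv hx).sub_const _).deriv]
        exact Lap_nonneg (fun _ => dl_nonneg) _
    exact h.congr fun x hx => (Lg_hasDeriv hx).deriv.symm

lemma log_Gamma {x : ℝ} (hx : 0 < x) : log (Gamma x) = Lg x := by
  have h : EqOn (fun x => exp (Lg x)) Gamma (Ioi 0) := by
    apply Real.eq_Gamma_of_log_convex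
    · refine Lg_convex.congr fun x _ => ?_
      simp
    · intro y hy
      have := L0_diff hy
      rw [show Lg (y+1) = log y + Lg y by unfold Lg; linarith, exp_add, exp_log hy]
    · exact fun _ => exp_pos _
    · simp [Lg, L0]
  rw [← h hx, log_exp]

noncomputable def dig : ℝ → ℝ := deriv (fun x => log (Gamma x))

lemma dig_eq {x : ℝ} (hx : 0 < x) : dig x = Ph x - L0 2 := by
  unfold dig
  rw [Filter.EventuallyEq.deriv_eq (f := Lg)]
  · exact (Lg_hasDeriv hx).deriv
  · filter_upwards [Ioi_mem_nhds hx] with y hy using log_Gamma hy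

lemma dig_deriv {x : ℝ} (hx : 0 < x) : deriv dig x = ph x := by
  rw [Filter.EventuallyEq.deriv_eq (f := fun x => Ph x - L0 2)]
  · exact ((Ph_hasDeriv hx).sub_const _).deriv
  · filter_upwards [Ioi_mem_nhds hx] with y hy using dig_eq hy

lemma dig_deriv2 {x : ℝ} (hx : 0 < x) : deriv (deriv dig) x = -Lap (fun t => t * dl t) x := by
  rw [Filter.EventuallyEq.deriv_eq (f := ph)]
  · exact (ph_hasDeriv hx).deriv
  · filter_upwards [Ioi_mem_nhds hx] with y hy using dig_deriv hy

end CMaux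
end

section
open Real Set Filter Topology MeasureTheory

namespace CMaux

lemma pB_lapInt : LapInt pB := by
  refine LapInt_of_bound pB_contOn 2 (fun t ht => ?_)
  rw [abs_of_nonneg (pB_nonneg ht)]
  nlinarith [pB_le ht, sq_nonneg (t^2 - 1), sq_nonneg (t-1)]

lemma pA_lapInt : LapInt pA := by
  refine LapInt_of_bound (pA_contOn.mono Ioi_subset_Ici_self) 2 (fun t ht => ?_)
  rw [abs_of_nonneg (pA_nonneg ht.le)]
  nlinarith [pA_le ht.le, sq_nonneg (t^2 - 1), sq_nonneg (t-1)]

lemma pO_lapInt : LapInt pO := by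
  refine LapInt_of_bound (pO_contOn.mono Ioi_subset_Ici_self) 2 (fun t ht => ?_)
  rw [abs_of_nonneg (pO_nonneg ht.le)]
  nlinarith [pO_le ht.le, sq_nonneg (t^2 - 1), sq_nonneg (t^2-t), sq_nonneg (t-1)]

lemma aO_pos {t : ℝ} (ht : 0 < t) : 0 < aO t := by
  have := exp_sub_pos ht
  unfold aO; positivity

lemma qO_nonneg {t : ℝ} (ht : 0 < t) : 0 ≤ qO t := by
  have := aO_pos ht
  have := pO_nonneg ht.le
  unfold qO; positivity

lemma qO_le {t : ℝ} (ht : 0 < t) : qO t ≤ t^2/6 + t^3/6 := by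
  have h1 := aO_pos ht
  have h2 := pO_le ht.le
  have h3 := dl_le ht
  have h4 : aO t * pO t ≤ aO t * (t^3/12) := mul_le_mul_of_nonneg_left h2 h1.le
  have h5 : dl t * (t^2/12) ≤ (1+t) * (t^2/12) := mul_le_mul_of_nonneg_right h3 (by positivity)
  unfold dl at h5
  unfold qO
  nlinarith

lemma qO_lapInt : LapInt qO := by
  refine LapInt_of_bound (fun t ht => (qO_hasDeriv ht).continuousAt.continuousWithinAt) 2 (fun t ht => ?_)
  rw [abs_of_nonneg (qO_nonneg ht)]
  nlinarith [qO_le ht, sq_nonneg (t^2 - 1), sq_nonneg (t^2-t), sq_nonneg (t-1)]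

lemma Lap_pA {x : ℝ} (hx : 0 < x) : x * Lap pA x = Lap pB x := by
  refine Lap_ibp (pA_contOn 0 self_mem_Ici) (by simp [pA]) (fun t ht => pA_hasDeriv ht) pA_lapInt pB_lapInt hx ?_
  refine exp_lim_of_bound 2 (1/4) (fun t ht => ?_) hx
  rw [abs_of_nonneg (pA_nonneg ht.le)]; linarith [pA_le ht.le]

lemma Lap_pO {x : ℝ} (hx : 0 < x) : x * Lap pO x = Lap pA x := by
  refine Lap_ibp (pO_contOn 0 self_mem_Ici) (by simp [pO]) (fun t ht => pO_hasDeriv ht) pO_lapInt pA_lapInt hx ?_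
  refine exp_lim_of_bound 3 (1/12) (fun t ht => ?_) hx
  rw [abs_of_nonneg (pO_nonneg ht.le)]; linarith [pO_le ht.le]

lemma Lap_pB {x : ℝ} (hx : 0 < x) : Lap pB x = ph x - 1/x - 1/(2*x^2) := by
  have h1 : LapInt (fun t : ℝ => t^0 + (1/2) * t^1) := by
    refine LapInt_of_bound (by fun_prop) 2 (fun t ht => ?_)
    rw [abs_of_nonneg (by positivity)]
    nlinarith [sq_nonneg (t^2 - 1), sq_nonneg (t-1)]
  have h2 : LapInt (fun t : ℝ => (1/2) * t^1) := by
    refine LapInt_of_bound (by fun_prop) 2 (fun t ht => ?_)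
    rw [abs_of_nonneg (by positivity)]
    nlinarith [sq_nonneg (t^2 - 1), sq_nonneg (t-1)]
  have h : ph x = Lap pB x + (Lap (fun t => t^0) x + (1/2) * Lap (fun t => t^1) x) := by
    rw [← Lap_const_mul, ← Lap_add (LapInt_pow 0) h2 hx, ← Lap_add pB_lapInt h1 hx]
    apply Lap_congr
    intro t ht; rw [dl_eq ht]; ring
  rw [h, Lap_pow 0 hx, Lap_pow 1 hx]
  norm_num
  field_simp
  ring

lemma Q_diff {x : ℝ} (hx : 0 < x) :
    Lap qO x - Lap qO (x+1) = 2/x^2 * (ph x - 1/x - 1/(2*x^2)) := by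
  rw [Lap_diff qO_lapInt hx, Lap_congr (g := fun t => 2 * pO t), Lap_const_mul, ← Lap_pB hx,
    ← Lap_pA hx, ← Lap_pO hx]
  · field_simp
  · intro t ht
    have := exp_sub_pos ht
    unfold qO aO; rw [exp_neg]; field_simp

noncomputable def ff (x : ℝ) : ℝ := ph x ^2 - Lap (fun t => t * dl t) x

lemma ff_diff {x : ℝ} (hx : 0 < x) :
    ff x - ff (x+1) = 2/x^2 * (ph x - 1/x - 1/(2*x^2)) := by
  have h1 := ph_diff hx
  have h2 : Lap (fun t => t * dl t) x - Lap (fun t => t * dl t) (x+1) = 2/x^3 := by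
    rw [Lap_diff tdl_int hx, Lap_congr (g := fun t => t^2), Lap_pow 2 hx]
    · norm_num [Nat.factorial]
    · intro t ht; rw [mul_assoc, dl_mul ht]; ring
  have h3 : ph (x+1) = ph x - 1/x^2 := by linarith
  have h4 : ff x - ff (x+1) = ph x^2 - ph (x+1)^2 - 2/x^3 := by unfold ff; linarith
  rw [h4, h3]
  field_simp
  ring

lemma ff_eq {x : ℝ} (hx : 0 < x) : ff x = Lap qO x := by
  have hp : ∀ n : ℕ, ff (x+n) - Lap qO (x+n) = ff x - Lap qO x := by
    intro n
    induction n with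
    | zero => simp
    | succ n ih =>
      have hn : 0 < x + n := by positivity
      have h1 := ff_diff hn
      have h2 := Q_diff hn
      push_cast
      rw [← add_assoc]
      linarith
  have h1 := (((Lap_tendsto dl_int hx).pow 2).sub (Lap_tendsto tdl_int hx)).sub (Lap_tendsto qO_lapInt hx)
  have h2 : Tendsto (fun n : ℕ => ff (x+n) - Lap qO (x+n)) atTop (𝓝 0) := by
    simpa [ff, ph] using h1
  simp only [hp] at h2
  have := tendsto_nhds_unique h2 tendsto_const_nhds
  linarith

end CMaux
end

section
open Real Set Filter Topology MeasureTheory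

namespace CMaux

lemma lh_pow {f f' : ℝ → ℝ} {c : ℝ} (k : ℕ) (hd : ∀ t, 0 < t → HasDerivAt f (f' t) t)
    (h0 : Tendsto f (𝓝[>] 0) (𝓝 0))
    (h : Tendsto (fun t => f' t / t^k) (𝓝[>] 0) (𝓝 c)) :
    Tendsto (fun t => f t / t^(k+1)) (𝓝[>] 0) (𝓝 (c/(k+1))) := by
  have hs : ∀ᶠ t : ℝ in 𝓝[>] 0, 0 < t := self_mem_nhdsWithin
  refine HasDerivAt.lhopital_zero_nhdsGT (f' := f') (g' := fun t => ((k+1 : ℕ):ℝ) * t^k)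
    (hs.mono hd) ?_ ?_ h0 ?_ ?_
  · exact Eventually.of_forall fun t => by simpa using hasDerivAt_pow (k+1) t
  · filter_upwards [hs] with t ht
    positivity
  · have : Tendsto (fun t : ℝ => t^(k+1)) (𝓝 0) (𝓝 (0^(k+1))) := (continuous_pow (k+1)).tendsto 0
    simp only [ne_eq, Nat.succ_ne_zero, not_false_eq_true, zero_pow] at this
    exact this.mono_left nhdsWithin_le_nhds
  · refine (h.div_const ((k:ℝ)+1)).congr fun t => ?_
    push_cast
    rw [div_div, mul_comm]

lemma lim_of_cont {f : ℝ → ℝ} (hf : Continuous f) {c : ℝ} (h : f 0 = c) :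
    Tendsto f (𝓝[>] 0) (𝓝 c) := by
  rw [← h]; exact (hf.tendsto 0).mono_left nhdsWithin_le_nhds

lemma lim_E : Tendsto (fun t => (exp t - 1)/t) (𝓝[>] 0) (𝓝 1) := by
  have := lh_pow (f := fun t => exp t - 1) (f' := exp) (c := 1) 0
    (fun t _ => (hasDerivAt_exp t).sub_const 1) (lim_of_cont (by fun_prop) (by simp))
    (by simpa using lim_of_cont continuous_exp exp_zero)
  simpa using this

lemma lim_E2 : Tendsto (fun t => (exp t - 1 - t)/t^2) (𝓝[>] 0) (𝓝 (1/2)) := by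
  have := lh_pow (f := fun t => exp t - 1 - t) (f' := fun t => exp t - 1) (c := 1) 1
    (fun t _ => ((hasDerivAt_exp t).sub_const 1).sub (hasDerivAt_id t))
    (lim_of_cont (by fun_prop) (by simp)) (by simpa using lim_E)
  norm_num at this ⊢
  exact this

lemma lim_N : Tendsto (fun t => ((exp t^2 - 1)/2 - t * exp t)/t^3) (𝓝[>] 0) (𝓝 (1/6)) := by
  have := lh_pow (f := fun t => (exp t^2 - 1)/2 - t * exp t)
    (f' := fun t => exp t * (exp t - 1 - t)) (c := 1/2) 2
    (fun t _ => (((((hasDerivAt_exp t).pow 2).sub_const 1).div_const 2).sub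
      ((hasDerivAt_id t).mul (hasDerivAt_exp t))).congr_deriv (by simp; ring))
    (lim_of_cont (by fun_prop) (by simp)) (by
      have := (lim_of_cont continuous_exp exp_zero).mul lim_E2
      simpa [mul_div_assoc] using this)
  norm_num at this ⊢
  exact this

lemma ev_pos : ∀ᶠ t : ℝ in 𝓝[>] 0, 0 < t := self_mem_nhdsWithin

lemma lim_pC : Tendsto (fun t => pC t/t) (𝓝[>] 0) (𝓝 (1/6)) := by
  have := lim_N.div (lim_E.pow 2) (by norm_num)
  norm_num at this ⊢
  refine this.congr' ?_
  filter_upwards [ev_pos] with t ht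
  have := exp_sub_pos ht
  simp only [Pi.div_apply]
  unfold pC; field_simp

lemma lim_pB : Tendsto (fun t => pB t/t^2) (𝓝[>] 0) (𝓝 (1/12)) := by
  have h0 : Tendsto pB (𝓝[>] 0) (𝓝 0) := by
    refine tendsto_of_tendsto_of_tendsto_of_le_of_le' tendsto_const_nhds
      (lim_of_cont (f := fun t => t/2) (by fun_prop) (by simp)) ?_ ?_
    · filter_upwards [ev_pos] with t ht using pB_nonneg ht
    · filter_upwards [ev_pos] with t ht using pB_le ht
  have := lh_pow 1 (fun t ht => pB_hasDeriv ht) h0 (by simpa using lim_pC)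
  norm_num at this ⊢
  exact this

lemma lim_pA : Tendsto (fun t => pA t/t^3) (𝓝[>] 0) (𝓝 (1/36)) := by
  have h0 : Tendsto pA (𝓝[>] 0) (𝓝 0) := by
    have := (pA_contOn 0 self_mem_Ici).mono Ioi_subset_Ici_self
    simpa [ContinuousWithinAt, pA] using this
  have := lh_pow 2 (fun t ht => pA_hasDeriv ht) h0 lim_pB
  norm_num at this ⊢
  exact this

lemma lim_pO : Tendsto (fun t => pO t/t^4) (𝓝[>] 0) (𝓝 (1/144)) := by
  have h0 : Tendsto pO (𝓝[>] 0) (𝓝 0) := by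
    have := (pO_contOn 0 self_mem_Ici).mono Ioi_subset_Ici_self
    simpa [ContinuousWithinAt, pO] using this
  have := lh_pow 3 (fun t ht => pO_hasDeriv ht) h0 lim_pA
  norm_num at this ⊢
  exact this

lemma lim_aO : Tendsto (fun t => t * aO t) (𝓝[>] 0) (𝓝 1) := by
  have := (lim_of_cont continuous_exp exp_zero).div lim_E (by norm_num)
  norm_num at this
  refine this.congr' ?_
  filter_upwards [ev_pos] with t ht
  have := exp_sub_pos ht
  simp only [Pi.div_apply]
  unfold aO; field_simp

lemma lim_aA : Tendsto (fun t => t^2 * aA t) (𝓝[>] 0) (𝓝 (-1)) := by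
  have := ((lim_of_cont continuous_exp exp_zero).div (lim_E.pow 2) (by norm_num))
  norm_num at this
  refine this.neg.congr' ?_
  filter_upwards [ev_pos] with t ht
  have := exp_sub_pos ht
  simp only [Pi.div_apply]
  unfold aA; field_simp

lemma lim_aB : Tendsto (fun t => t^3 * aB t) (𝓝[>] 0) (𝓝 2) := by
  have := ((lim_of_cont (f := fun t => exp t * (exp t + 1)) (c := 2) (by fun_prop) (by norm_num)).div
    (lim_E.pow 3) (by norm_num))
  norm_num at this
  refine this.congr' ?_
  filter_upwards [ev_pos] with t ht
  have := exp_sub_pos ht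
  simp only [Pi.div_apply]
  unfold aB; field_simp

lemma lim_aC : Tendsto (fun t => t^4 * aC t) (𝓝[>] 0) (𝓝 (-6)) := by
  have := ((lim_of_cont (f := fun t => exp t * (exp t^2 + 4 * exp t + 1)) (c := 6) (by fun_prop)
    (by norm_num)).div (lim_E.pow 4) (by norm_num))
  norm_num at this
  refine this.neg.congr' ?_
  filter_upwards [ev_pos] with t ht
  have := exp_sub_pos ht
  simp only [Pi.div_apply]
  unfold aC; field_simp

lemma lim_id : Tendsto (fun t : ℝ => t) (𝓝[>] 0) (𝓝 0) := lim_of_cont continuous_id rfl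

lemma lim_qO : Tendsto qO (𝓝[>] 0) (𝓝 0) := by
  have := ((lim_aO.mul lim_pO).const_mul 2).mul (lim_id.pow 3)
  norm_num at this
  refine this.congr' ?_
  filter_upwards [ev_pos] with t ht
  unfold qO; field_simp

lemma lim_qA : Tendsto qA (𝓝[>] 0) (𝓝 0) := by
  have := (((lim_aO.mul lim_pA).add (lim_aA.mul lim_pO)).const_mul 2).mul (lim_id.pow 2)
  norm_num at this
  refine this.congr' ?_
  filter_upwards [ev_pos] with t ht
  unfold qA; field_simp

lemma lim_qB : Tendsto qB (𝓝[>] 0) (𝓝 0) := by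
  have := ((((lim_aO.mul lim_pB).add ((lim_aA.mul lim_pA).const_mul 2)).add
    (lim_aB.mul lim_pO)).const_mul 2).mul lim_id
  norm_num at this
  refine this.congr' ?_
  filter_upwards [ev_pos] with t ht
  unfold qB; field_simp

lemma lim_qC : Tendsto qC (𝓝[>] 0) (𝓝 (1/12)) := by
  have := ((((lim_aO.mul lim_pC).add ((lim_aA.mul lim_pB).const_mul 3)).add
    ((lim_aB.mul lim_pA).const_mul 3)).add (lim_aC.mul lim_pO)).const_mul 2
  norm_num at this ⊢
  refine this.congr' ?_
  filter_upwards [ev_pos] with t ht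
  unfold qC; field_simp

noncomputable def uu (t : ℝ) : ℝ := (exp t - 1)⁻¹

lemma lim_u : Tendsto uu atTop (𝓝 0) :=
  tendsto_inv_atTop_zero.comp (tendsto_atTop_add_const_right _ (-1) tendsto_exp_atTop)

lemma ev_posT : ∀ᶠ t : ℝ in atTop, 0 < t := eventually_gt_atTop 0

lemma limT_aO : Tendsto aO atTop (𝓝 1) := by
  have := lim_u.const_add 1
  norm_num at this
  refine this.congr' ?_
  filter_upwards [ev_posT] with t ht
  have := exp_sub_pos ht
  unfold aO uu; field_simp; ring

lemma limT_aA : Tendsto aA atTop (𝓝 0) := by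
  have := (lim_u.add (lim_u.pow 2)).neg
  norm_num at this
  refine this.congr' ?_
  filter_upwards [ev_posT] with t ht
  have := exp_sub_pos ht
  unfold aA uu; field_simp; ring

lemma limT_aB : Tendsto aB atTop (𝓝 0) := by
  have := ((lim_u.const_add 1).mul ((lim_u.const_mul 2).const_add 1)).mul lim_u
  norm_num at this
  refine this.congr' ?_
  filter_upwards [ev_posT] with t ht
  have := exp_sub_pos ht
  unfold aB uu; field_simp; ring

lemma limT_aC : Tendsto aC atTop (𝓝 0) := by
  have h1 := lim_u.const_add 1
  have := ((h1.mul lim_u).mul (((h1.pow 2).add ((h1.mul lim_u).const_mul 4)).add (lim_u.pow 2))).neg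
  norm_num at this
  refine this.congr' ?_
  filter_upwards [ev_posT] with t ht
  have := exp_sub_pos ht
  unfold aC uu; field_simp; ring


lemma limT_pO {x : ℝ} (hx : 0 < x) : Tendsto (fun t => exp (-(x*t)) * pO t) atTop (𝓝 0) := by
  refine exp_lim_of_bound 3 (1/12) (fun t ht => ?_) hx
  rw [abs_of_nonneg (pO_nonneg ht.le)]; linarith [pO_le ht.le]

lemma limT_pA {x : ℝ} (hx : 0 < x) : Tendsto (fun t => exp (-(x*t)) * pA t) atTop (𝓝 0) := by
  refine exp_lim_of_bound 2 (1/4) (fun t ht => ?_) hx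
  rw [abs_of_nonneg (pA_nonneg ht.le)]; linarith [pA_le ht.le]

lemma limT_pB {x : ℝ} (hx : 0 < x) : Tendsto (fun t => exp (-(x*t)) * pB t) atTop (𝓝 0) := by
  refine exp_lim_of_bound 1 (1/2) (fun t ht => ?_) hx
  rw [abs_of_nonneg (pB_nonneg ht)]; linarith [pB_le ht]

lemma limT_pC {x : ℝ} (hx : 0 < x) : Tendsto (fun t => exp (-(x*t)) * pC t) atTop (𝓝 0) := by
  have h0 := exp_poly_lim 0 hx
  have h1 := exp_poly_lim 1 hx
  have := (h0.mul (((lim_u.const_mul 2).const_add 1).div_const 2)).sub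
    (h1.mul (lim_u.mul (lim_u.const_add 1)))
  norm_num at this
  refine this.congr' ?_
  filter_upwards [ev_posT] with t ht
  have := exp_sub_pos ht
  unfold pC uu; field_simp; ring

noncomputable def bd (x t : ℝ) : ℝ := exp (-(x*t)) * (x^3 * qO t + x^2 * qA t + x * qB t + qC t)

lemma bd_limT {x : ℝ} (hx : 0 < x) : Tendsto (bd x) atTop (𝓝 0) := by
  have hO := limT_pO hx
  have hA := limT_pA hx
  have hB := limT_pB hx
  have hC := limT_pC hx
  have eO := (limT_aO.mul hO).const_mul (2 * x^3)
  have eA := ((limT_aO.mul hA).add (limT_aA.mul hO)).const_mul (2 * x^2)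
  have eB := (((limT_aO.mul hB).add ((limT_aA.mul hA).const_mul 2)).add (limT_aB.mul hO)).const_mul (2 * x)
  have eC := ((((limT_aO.mul hC).add ((limT_aA.mul hB).const_mul 3)).add
    ((limT_aB.mul hA).const_mul 3)).add (limT_aC.mul hO)).const_mul 2
  have := ((eO.add eA).add eB).add eC
  simp only [mul_zero, add_zero] at this
  refine this.congr fun t => ?_
  unfold bd qO qA qB qC
  ring

lemma bd_lim0 {x : ℝ} : Tendsto (bd x) (𝓝[>] 0) (𝓝 (1/12)) := by
  have := (lim_of_cont (f := fun t => exp (-(x*t))) (c := 1) (by fun_prop) (by simp)).mul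
    ((((lim_qO.const_mul (x^3)).add (lim_qA.const_mul (x^2))).add (lim_qB.const_mul x)).add lim_qC)
  norm_num at this ⊢
  exact this

lemma bd_hasDeriv {x : ℝ} {t : ℝ} (ht : 0 < t) :
    HasDerivAt (bd x) (exp (-(x*t)) * qD t - x^4 * (exp (-(x*t)) * qO t)) t := by
  have h1 : HasDerivAt (fun t => exp (-(x*t))) (exp (-(x*t)) * (-(x * 1))) t :=
    (((hasDerivAt_id t).const_mul x).neg).exp
  have := h1.mul (((((qO_hasDeriv ht).const_mul (x^3)).add ((qA_hasDeriv ht).const_mul (x^2))).add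
    ((qB_hasDeriv ht).const_mul x)).add (qC_hasDeriv ht))
  refine this.congr_deriv ?_
  simp only [Pi.add_apply]
  ring

noncomputable def JJ (x t : ℝ) : ℝ := ∫ s in (0:ℝ)..t, exp (-(x*s)) * qO s

lemma JJ_hasDeriv {x : ℝ} (hx : 0 < x) {t : ℝ} (ht : 0 < t) : HasDerivAt (JJ x) (exp (-(x*t)) * qO t) t := by
  have hc : ContinuousOn (fun s => exp (-(x*s)) * qO s) (Ioi 0) :=
    ContinuousOn.mul (by fun_prop) (fun t ht => (qO_hasDeriv ht).continuousAt.continuousWithinAt)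
  apply intervalIntegral.integral_hasDerivAt_right
  · rw [intervalIntegrable_iff_integrableOn_Ioc_of_le ht.le]
    exact (qO_lapInt x hx).mono_set Ioc_subset_Ioi_self
  · exact ContinuousOn.stronglyMeasurableAtFilter isOpen_Ioi hc t ht
  · exact hc.continuousAt (Ioi_mem_nhds ht)

lemma JJ_lim0 {x : ℝ} (hx : 0 < x) : Tendsto (JJ x) (𝓝[>] 0) (𝓝 0) := by
  have hi : IntegrableOn (fun s => exp (-(x*s)) * qO s) (uIcc 0 1) := by
    rw [uIcc_of_le zero_le_one, integrableOn_Icc_iff_integrableOn_Ioc]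
    exact (qO_lapInt x hx).mono_set Ioc_subset_Ioi_self
  have h := intervalIntegral.continuousOn_primitive_interval hi 0 (by simp)
  rw [uIcc_of_le zero_le_one] at h
  have h2 : Tendsto (JJ x) (𝓝[Icc 0 1] 0) (𝓝 0) := by
    unfold ContinuousWithinAt at h
    simp only [intervalIntegral.integral_same] at h
    exact h
  refine h2.mono_left ?_
  rw [nhdsWithin_Icc_eq_nhdsGE zero_lt_one]
  exact nhdsWithin_mono _ Ioi_subset_Ici_self

lemma JJ_limT {x : ℝ} (hx : 0 < x) : Tendsto (JJ x) atTop (𝓝 (Lap qO x)) :=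
  intervalIntegral_tendsto_integral_Ioi 0 (qO_lapInt x hx) tendsto_id

lemma main6 {x : ℝ} (hx : 0 < x) : IntegrableOn (fun t => exp (-(x*t)) * qD t) (Ioi 0) ∧
    Lap qD x = x^4 * Lap qO x - 1/12 := by
  let G : ℝ → ℝ := fun t => if t ≤ 0 then 1/12 else bd x t + x^4 * JJ x t
  have hG0 : G 0 = 1/12 := by simp [G]
  have hGp : ∀ t, 0 < t → G t = bd x t + x^4 * JJ x t := fun t ht => by simp [G, not_le.2 ht]
  have hcont : ContinuousWithinAt G (Ici 0) 0 := by
    rw [← continuousWithinAt_Ioi_iff_Ici]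
    unfold ContinuousWithinAt
    rw [hG0]
    have := (bd_lim0 (x := x)).add ((JJ_lim0 hx).const_mul (x^4))
    rw [mul_zero, add_zero] at this
    refine this.congr' ?_
    filter_upwards [ev_pos] with t ht
    rw [hGp t ht]
  have hder : ∀ t ∈ Ioi (0:ℝ), HasDerivAt G (exp (-(x*t)) * qD t) t := by
    intro t ht
    have h := (bd_hasDeriv (x := x) ht).add ((JJ_hasDeriv hx ht).const_mul (x^4))
    refine (h.congr_deriv (by ring)).congr_of_eventuallyEq ?_
    filter_upwards [Ioi_mem_nhds ht] with s hs
    rw [hGp s hs]; rfl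
  have hlim : Tendsto G atTop (𝓝 (x^4 * Lap qO x)) := by
    have := (bd_limT hx).add ((JJ_limT hx).const_mul (x^4))
    rw [zero_add] at this
    refine this.congr' ?_
    filter_upwards [ev_posT] with t ht
    rw [hGp t ht]
  have hint := integrableOn_Ioi_deriv_of_nonneg hcont hder
    (fun t ht => mul_nonneg (exp_pos _).le (qD_nonneg ht)) hlim
  refine ⟨hint, ?_⟩
  have := integral_Ioi_of_hasDerivAt_of_tendsto hcont hder hint hlim
  rw [hG0] at this
  exact this

lemma qD_lapInt : LapInt qD := fun _ hx => (main6 hx).1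

end CMaux
end


theorem x4_Psi_completely_monotonic (n : ℕ) (x : ℝ) (hx : 0 < x) :
    0 ≤ (-1 : ℝ) ^ n *
      iteratedDeriv n (fun y => y ^ 4 * ((deriv digamma y) ^ 2 + deriv (deriv digamma) y)) x := by
  have hdig : digamma = CMaux.dig := rfl
  have hev : (fun y => y ^ 4 * ((deriv digamma y) ^ 2 + deriv (deriv digamma) y)) =ᶠ[nhds x]
      (fun y => 1/12 + CMaux.Lap CMaux.qD y) := by
    filter_upwards [Ioi_mem_nhds hx] with y hy
    have h1 := (CMaux.main6 hy).2
    have h2 := CMaux.ff_eq hy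
    rw [hdig, CMaux.dig_deriv hy, CMaux.dig_deriv2 hy, h1, ← h2]
    unfold CMaux.ff
    ring
  have hder : iteratedDeriv n (fun y => y ^ 4 * ((deriv digamma y) ^ 2 + deriv (deriv digamma) y)) x
      = iteratedDeriv n (fun y => 1/12 + CMaux.Lap CMaux.qD y) x := hev.iteratedDeriv_eq n
  rw [hder]
  have hnn : ∀ m : ℕ, 0 ≤ CMaux.Lap (fun t => t^m * CMaux.qD t) x := fun m =>
    CMaux.Lap_nonneg (fun t ht => mul_nonneg (by positivity) (CMaux.qD_nonneg ht)) x
  rcases Nat.eq_zero_or_pos n with h0 | h0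
  · subst h0
    have := hnn 0
    simp at this ⊢
    linarith
  · rw [iteratedDeriv_const_add h0,
      CMaux.Lap_iteratedDeriv CMaux.qD_lapInt (fun t ht => CMaux.qD_nonneg ht) hx n,
      ← mul_assoc, ← mul_pow]
    simpa using hnn n
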